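/- arXiv:2412.07358 — 4 statements merged into one kernel-verified Lean document; each statement's English description precedes it below -/
import Mathlib

section
/- Let S be a scheme and let X₁ → X₃ and X₂ → X₃ be morphisms of schemes over S such that X₁, X₂ and X₃ are all fet over S. Then the fiber product X₁ ×_{X₃} X₂ is fet over S. -/
open AlgebraicGeometry CategoryTheory CategoryTheory.Limits

universe u

/-- A morphism of schemes is *fet* if it factors as a finite étale morphism followed by
an open immersion. -/
def IsFet {X Y : Scheme.{u}} (f : X ⟶ Y) : Prop :=
  ∃ (Z : Scheme.{u}) (g : X ⟶ Z) (h : Z ⟶ Y),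
    IsFinite g ∧ IsEtale g ∧ IsOpenImmersion h ∧ g ≫ h = f

/-- if `X₁`, `X₂`, `X₃` are fet over `S` and `X₁ ⟶ X₃`, `X₂ ⟶ X₃` are
`S`-morphisms, then the fiber product `X₁ ×_{X₃} X₂` is fet over `S`. -/
theorem isFet_pullback {S X₁ X₂ X₃ : Scheme.{u}}
    (p₁ : X₁ ⟶ S) (p₂ : X₂ ⟶ S) (p₃ : X₃ ⟶ S)
    (f₁ : X₁ ⟶ X₃) (f₂ : X₂ ⟶ X₃)
    (hf₁ : f₁ ≫ p₃ = p₁) (hf₂ : f₂ ≫ p₃ = p₂)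
    (h₁ : IsFet p₁) (h₂ : IsFet p₂) (h₃ : IsFet p₃) :
    IsFet (pullback.fst f₁ f₂ ≫ p₁) := by
  subst hf₁ hf₂
  have hsep : IsSeparated p₃ := by
    obtain ⟨Z, g, h, _, _, _, rfl⟩ := h₃
    infer_instance
  have het : Etale p₃ := by
    obtain ⟨Z, g, h, _, hg, _, rfl⟩ := h₃
    have : Etale g := hg
    infer_instance
  have e1 : IsFinite (pullback.mapDesc f₁ f₂ p₃) := inferInstance
  have e2 : Etale (pullback.mapDesc f₁ f₂ p₃) :=
    MorphismProperty.of_isPullback (P := @Etale) (pullback_map_diagonal_isPullback f₁ f₂ p₃)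
      inferInstance
  obtain ⟨Z₁, g₁, i₁, hg₁, hg₁', hi₁, e₁⟩ := h₁
  obtain ⟨Z₂, g₂, i₂, hg₂, hg₂', hi₂, e₂⟩ := h₂
  let m : pullback (f₁ ≫ p₃) (f₂ ≫ p₃) ⟶ pullback i₁ i₂ :=
    pullback.map _ _ _ _ g₁ g₂ (𝟙 _) (by simp [e₁]) (by simp [e₂])
  have m1 : IsFinite m := by
    have := MorphismProperty.pullbackMap (P := @IsFinite) (f' := i₁) (g' := i₂)
      hg₁ hg₂ e₁.symm e₂.symm
    exact this
  have k₁ : Etale g₁ := hg₁'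
  have k₂ : Etale g₂ := hg₂'
  have : MorphismProperty.IsMultiplicative @Etale.{u} := inferInstance
  have : MorphismProperty.IsStableUnderComposition @Etale.{u} := this.toIsStableUnderComposition
  have m2 : Etale m := by
    have := MorphismProperty.pullbackMap (P := @Etale) (f' := i₁) (g' := i₂)
      k₁ k₂ e₁.symm e₂.symm
    exact this
  refine ⟨pullback i₁ i₂, pullback.mapDesc f₁ f₂ p₃ ≫ m, pullback.fst i₁ i₂ ≫ i₁,
    inferInstance, (inferInstance : Etale _), inferInstance, ?_⟩
  simp only [m, pullback.mapDesc, pullback.map, Category.assoc, pullback.lift_fst_assoc, e₁,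
    Category.id_comp, Category.comp_id]
end

section
/- Let f : X → S be an integral morphism of schemes with X irreducible and S locally henselian. Then the image f(X) is closed in S and f induces a homeomorphism from X onto f(X); equivalently, the underlying continuous map of f is a closed embedding of topological spaces. -/
open AlgebraicGeometry CategoryTheory

universe u

/-- A scheme is *locally henselian* if all of its local rings (stalks) are henselian. -/
def Scheme.IsLocallyHenselian (S : Scheme.{u}) : Prop :=
  ∀ s : S, HenselianLocalRing (S.presheaf.stalk s)

section Core
open Polynomial

lemma symm_lift {A C : Type*} [CommRing A] [CommRing C] [Algebra A C] {n : ℕ}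
    (x : Fin n → C) (f : A[X])
    (hf : f.map (algebraMap A C) = ∏ i, (X - Polynomial.C (x i)))
    (q : MvPolynomial (Fin n) ℤ) (hq : q.IsSymmetric) :
    ∃ a : A, algebraMap A C a = MvPolynomial.aeval x q := by
  classical
  have key : ∀ k, k ≤ n → ∃ a : A, algebraMap A C a =
      MvPolynomial.aeval x (MvPolynomial.esymm (Fin n) ℤ k) := by
    intro k hk
    refine ⟨(-1) ^ k * f.coeff (n - k), ?_⟩
    rw [map_mul, ← Polynomial.coeff_map, hf, MvPolynomial.aeval_esymm_eq_multiset_esymm]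
    have h := Multiset.prod_X_sub_C_coeff (Finset.univ.val.map x) (k := n - k) (by simp)
    rw [Multiset.map_map] at h
    have h2 : (Multiset.map ((fun t ↦ X - Polynomial.C t) ∘ x) Finset.univ.val).prod
      = ∏ i, (X - Polynomial.C (x i)) := rfl
    rw [h2] at h
    rw [h]
    have h3 : Multiset.card (Finset.univ.val.map x) - (n - k) = k := by simp; omega
    rw [h3, ← mul_assoc, map_pow, map_neg, map_one, ← mul_pow]
    simp
  let e := MvPolynomial.esymmAlgEquiv (σ := Fin n) (R := ℤ) (n := n) (by simp)
  obtain ⟨p, hp⟩ := e.surjective ⟨q, hq⟩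
  choose g hg using fun i : Fin n => key (i + 1) i.2
  refine ⟨MvPolynomial.aeval g p, ?_⟩
  have h1 : q = MvPolynomial.aeval (fun i : Fin n => MvPolynomial.esymm (Fin n) ℤ (i + 1)) p := by
    rw [← MvPolynomial.esymmAlgHom_apply]
    exact (congrArg Subtype.val hp).symm
  have h2 := MvPolynomial.comp_aeval_apply (R := ℤ) g (algebraMap A C).toIntAlgHom p
  have h3 := MvPolynomial.comp_aeval_apply (R := ℤ)
    (fun i : Fin n => MvPolynomial.esymm (Fin n) ℤ (i + 1)) (MvPolynomial.aeval x) p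
  rw [h1, h3]
  simp_rw [← hg]
  exact h2

lemma poly_lift {A C : Type*} [CommRing A] [CommRing C] [Nontrivial C] [Algebra A C] {n : ℕ}
    (x : Fin n → C) (f : A[X])
    (hf : f.map (algebraMap A C) = ∏ i, (X - Polynomial.C (x i))) (k : ℕ) :
    ∃ P : A[X], P.Monic ∧ P.map (algebraMap A C) =
      ∏ I ∈ Finset.powersetCard k (Finset.univ : Finset (Fin n)),
        (X - Polynomial.C (∏ i ∈ I, x i)) := by
  classical
  let Q : Polynomial (MvPolynomial (Fin n) ℤ) :=
    ∏ I ∈ Finset.powersetCard k (Finset.univ : Finset (Fin n)),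
        (X - Polynomial.C (∏ i ∈ I, MvPolynomial.X i))
  have hQ : Q.map (MvPolynomial.aeval x).toRingHom =
      ∏ I ∈ Finset.powersetCard k (Finset.univ : Finset (Fin n)),
        (X - Polynomial.C (∏ i ∈ I, x i)) := by
    simp [Q, Polynomial.map_prod, map_prod]
  have hsym : ∀ j, (Q.coeff j).IsSymmetric := by
    intro j e
    have : Q.map (MvPolynomial.rename (R := ℤ) e).toRingHom = Q := by
      simp only [Q, Polynomial.map_prod]
      refine Finset.prod_bij (fun I _ => I.map e.toEmbedding) ?_ ?_ ?_ ?_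
      · intro I hI
        simp only [Finset.mem_powersetCard_univ, Finset.card_map] at hI ⊢
        exact hI
      · intro I _ J _ h
        exact Finset.map_injective _ h
      · intro I hI
        refine ⟨I.map e.symm.toEmbedding, ?_, ?_⟩
        · simp only [Finset.mem_powersetCard_univ, Finset.card_map] at hI ⊢
          exact hI
        · ext; simp
      · intro I _
        rw [Polynomial.map_sub, Polynomial.map_X, Polynomial.map_C]
        simp [Finset.prod_map, map_prod]
    conv_rhs => rw [← this]
    rw [Polynomial.coeff_map]
    rfl
  have hl : (∏ I ∈ Finset.powersetCard k (Finset.univ : Finset (Fin n)),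
        (X - Polynomial.C (∏ i ∈ I, x i))) ∈ Polynomial.lifts (algebraMap A C) := by
    rw [← hQ, Polynomial.lifts_iff_coeff_lifts]
    intro j
    rw [Polynomial.coeff_map]
    exact symm_lift x f hf _ (hsym j)
  obtain ⟨P, h1, -, h3⟩ := Polynomial.lifts_and_degree_eq_and_monic hl
    (Polynomial.monic_prod_of_monic _ _ fun _ _ => Polynomial.monic_X_sub_C _)
  exact ⟨P, h3, h1⟩

lemma half {A C : Type*} [CommRing A] [CommRing C] [IsDomain C] [Algebra A C]
    [HenselianLocalRing A] [Algebra.IsIntegral A C] {n : ℕ}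
    (x : Fin n → C) (f : A[X])
    (hf : f.map (algebraMap A C) = ∏ i, (X - Polynomial.C (x i)))
    (M : Ideal C) [hM : M.IsMaximal] (I0 : Finset (Fin n)) (hI0 : ∀ i, i ∈ I0 ↔ x i ∉ M) :
    ∃ I : Finset (Fin n), I.card = I0.card ∧ ∀ i ∈ I, IsUnit (x i) := by
  classical
  obtain ⟨P, hPm, hP⟩ := poly_lift x f hf I0.card
  obtain ⟨a0, ha0⟩ := symm_lift x f hf (MvPolynomial.esymm (Fin n) ℤ I0.card)
    (MvPolynomial.esymm_isSymmetric _ _ _)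
  have hmem : ∀ a : A, a ∈ IsLocalRing.maximalIdeal A ↔ algebraMap A C a ∈ M := by
    intro a
    have : (M.comap (algebraMap A C)).IsMaximal := Ideal.isMaximal_comap_of_isIntegral_of_isMaximal M
    rw [← IsLocalRing.eq_maximalIdeal this, Ideal.mem_comap]
  let π := Ideal.Quotient.mk M
  have hz : ∀ I ∈ Finset.powersetCard I0.card (Finset.univ : Finset (Fin n)), I ≠ I0 →
      π (∏ i ∈ I, x i) = 0 := by
    intro I hI hne
    rw [Finset.mem_powersetCard_univ] at hI
    have : ¬ I ⊆ I0 := fun h => hne (Finset.eq_of_subset_of_card_le h hI.ge)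
    obtain ⟨i, hi, hi0⟩ := Finset.not_subset.1 this
    rw [map_prod]
    refine Finset.prod_eq_zero hi ?_
    rw [hI0, not_not] at hi0
    exact Ideal.Quotient.eq_zero_iff_mem.2 hi0
  have hI0mem : I0 ∈ Finset.powersetCard I0.card (Finset.univ : Finset (Fin n)) := by simp
  have hu : π (algebraMap A C a0) = π (∏ i ∈ I0, x i) := by
    rw [ha0, MvPolynomial.esymm, map_sum, map_sum, Finset.sum_eq_single_of_mem I0 hI0mem]
    · simp
    · intro I hI hne
      simpa using hz I hI hne
  have : M.IsPrime := hM.isPrime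
  have hune : π (algebraMap A C a0) ≠ 0 := by
    rw [hu, map_prod, Finset.prod_ne_zero_iff]
    intro i hi h
    exact (hI0 i).1 hi (Ideal.Quotient.eq_zero_iff_mem.1 h)
  have hev : ∀ (R : A[X]) (a : A), algebraMap A C (R.eval a) =
      (R.map (algebraMap A C)).eval (algebraMap A C a) := by
    intro R a; rw [Polynomial.eval_map, Polynomial.eval₂_at_apply]
  have hPM : (P.map (algebraMap A C)).map π = (X - Polynomial.C (π (algebraMap A C a0))) *
      X ^ ((Finset.powersetCard I0.card (Finset.univ : Finset (Fin n))).erase I0).card := by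
    rw [hP, Polynomial.map_prod, ← Finset.mul_prod_erase _ _ hI0mem, hu]
    congr 1
    · rw [Polynomial.map_sub, Polynomial.map_X, Polynomial.map_C]
    · rw [← Finset.prod_const]
      refine Finset.prod_congr rfl fun I hI => ?_
      rw [Finset.mem_erase] at hI
      rw [Polynomial.map_sub, Polynomial.map_X, Polynomial.map_C, hz I hI.2 hI.1]
      simp
  obtain ⟨θ, hθ, hθ'⟩ := HenselianLocalRing.is_henselian P hPm a0
    (by
      rw [hmem, ← Ideal.Quotient.eq_zero_iff_mem, hev, ← Polynomial.eval₂_at_apply,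
        ← Polynomial.eval_map]
      change eval (π _) (Polynomial.map π _) = 0
      rw [hPM]
      simp)
    (by
      rw [← IsLocalRing.notMem_maximalIdeal, hmem, ← Ideal.Quotient.eq_zero_iff_mem, hev,
        ← Polynomial.eval₂_at_apply, ← Polynomial.eval_map]
      change eval (π _) (Polynomial.map π _) ≠ 0
      rw [← Polynomial.derivative_map, ← Polynomial.derivative_map, hPM]
      simp [Polynomial.derivative_mul, hune])
  have hθu : IsUnit θ := by
    rw [← IsLocalRing.notMem_maximalIdeal]
    intro h
    apply hune
    rw [Ideal.Quotient.eq_zero_iff_mem, ← hmem]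
    simpa using Ideal.sub_mem _ h hθ'
  have h0 : (P.map (algebraMap A C)).eval (algebraMap A C θ) = 0 := by
    rw [← hev, hθ.eq_zero, map_zero]
  rw [hP, Polynomial.eval_prod, Finset.prod_eq_zero_iff] at h0
  obtain ⟨I, hI, h⟩ := h0
  rw [Finset.mem_powersetCard_univ] at hI
  refine ⟨I, hI, fun i hi => ?_⟩
  simp only [eval_sub, eval_X, eval_C, sub_eq_zero] at h
  have := hθu.map (algebraMap A C)
  rw [h] at this
  exact isUnit_of_dvd_unit (Finset.dvd_prod_of_mem x hi) this

lemma core {A C : Type*} [CommRing A] [CommRing C] [IsDomain C] [Algebra A C]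
    [HenselianLocalRing A] [Algebra.IsIntegral A C] {n : ℕ}
    (x : Fin n → C) (f : A[X])
    (hf : f.map (algebraMap A C) = ∏ i, (X - Polynomial.C (x i)))
    (M N : Ideal C) [hM : M.IsMaximal] [hN : N.IsMaximal] (i : Fin n) : x i ∈ M ↔ x i ∈ N := by
  classical
  let S (M : Ideal C) : Finset (Fin n) := Finset.univ.filter fun i => x i ∉ M
  have hS : ∀ M i, i ∈ S M ↔ x i ∉ M := by simp [S]
  suffices h : S M = S N by
    have := congrArg (i ∈ ·) h
    simp only [hS, eq_iff_iff, not_iff_not] at this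
    exact this
  have hsub : ∀ (M : Ideal C) [M.IsMaximal] (I : Finset (Fin n)), (∀ i ∈ I, IsUnit (x i)) →
      I ⊆ S M := by
    intro M hM I h i hi
    rw [hS]
    exact fun hm => hM.ne_top (Ideal.eq_top_of_isUnit_mem _ hm (h i hi))
  obtain ⟨I, hI, hIu⟩ := half x f hf M (S M) (hS M)
  obtain ⟨J, hJ, hJu⟩ := half x f hf N (S N) (hS N)
  have c1 := Finset.card_le_card (hsub N I hIu)
  have c2 := Finset.card_le_card (hsub M J hJu)
  rw [← Finset.eq_of_subset_of_card_le (hsub M I hIu) (by omega),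
    ← Finset.eq_of_subset_of_card_le (hsub N I hIu) (by omega)]

lemma isLocalRing_of_integral_domain {A B : Type*} [CommRing A] [CommRing B] [IsDomain B]
    [Algebra A B] [HenselianLocalRing A] [Algebra.IsIntegral A B]
    (m₁ m₂ : Ideal B) [m₁.IsMaximal] [m₂.IsMaximal] : m₁ = m₂ := by
  suffices H : ∀ (m₁ m₂ : Ideal B) [m₁.IsMaximal] [m₂.IsMaximal], m₁ ≤ m₂ from
    le_antisymm (H _ _) (H _ _)
  intro m₁ m₂ _ _ b hb
  let K := AlgebraicClosure (FractionRing B)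
  let D := integralClosure B K
  have hinj : Function.Injective (algebraMap B D) := by
    have h : Function.Injective (algebraMap B K) := by
      rw [IsScalarTower.algebraMap_eq B (FractionRing B) K]
      exact (algebraMap (FractionRing B) K).injective.comp (IsFractionRing.injective B _)
    rw [IsScalarTower.algebraMap_eq B D K, RingHom.coe_comp] at h
    exact Function.Injective.of_comp h
  have hAD : Algebra.IsIntegral A D := Algebra.IsIntegral.trans B
  obtain ⟨M₁, hM₁, e₁⟩ := Ideal.exists_ideal_over_maximal_of_isIntegral (S := D) m₁
    (by rw [(RingHom.injective_iff_ker_eq_bot _).1 hinj]; exact bot_le)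
  obtain ⟨M₂, hM₂, e₂⟩ := Ideal.exists_ideal_over_maximal_of_isIntegral (S := D) m₂
    (by rw [(RingHom.injective_iff_ker_eq_bot _).1 hinj]; exact bot_le)
  obtain ⟨f, hfm, hfb⟩ := Algebra.IsIntegral.isIntegral (R := A) b
  obtain ⟨n, x, hx⟩ : ∃ (n : ℕ) (x : Fin n → D),
      f.map (algebraMap A D) = ∏ i, (X - Polynomial.C (x i)) := by
    have hs := IsAlgClosed.splits (f.map (algebraMap A K))
    have hr := hs.eq_prod_roots
    rw [(hfm.map _).leadingCoeff, map_one, one_mul] at hr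
    set R := (f.map (algebraMap A K)).roots
    have hRi : ∀ y ∈ R, IsIntegral B y := by
      intro y hy
      have hy' : IsIntegral A y := ⟨f, hfm, by
        have := Polynomial.isRoot_of_mem_roots hy
        rwa [Polynomial.IsRoot, Polynomial.eval_map] at this⟩
      exact hy'.tower_top
    refine ⟨R.toList.length, fun i => ⟨R.toList.get i, hRi _ ?_⟩, ?_⟩
    · rw [← Multiset.mem_toList]; exact List.get_mem _ _
    · apply Polynomial.map_injective (algebraMap D K) Subtype.val_injective
      rw [Polynomial.map_map, ← IsScalarTower.algebraMap_eq, hr, Polynomial.map_prod]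
      simp only [Polynomial.map_sub, Polynomial.map_X, Polynomial.map_C]
      conv_lhs => rw [← Multiset.coe_toList R]
      rw [Multiset.map_coe, Multiset.prod_coe, ← List.prod_ofFn]
      congr 1
      conv_lhs => rw [← List.ofFn_get R.toList, List.map_ofFn]
      rfl
  have hb0 : (f.map (algebraMap A D)).eval (algebraMap B D b) = 0 := by
    rw [Polynomial.eval_map, IsScalarTower.algebraMap_eq A B D, ← Polynomial.hom_eval₂, hfb,
      map_zero]
  rw [hx, Polynomial.eval_prod, Finset.prod_eq_zero_iff] at hb0
  obtain ⟨i, -, hi⟩ := hb0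
  simp only [eval_sub, eval_X, eval_C, sub_eq_zero] at hi
  have := core x f hx M₁ M₂ i
  rw [← hi, ← Ideal.mem_comap, ← Ideal.mem_comap, e₁, e₂] at this
  exact this.1 hb

lemma primes_eq_domain {A B L : Type*} [CommRing A] [CommRing B] [CommRing L] [Algebra A B]
    [Algebra A L] [Algebra.IsIntegral A B] [IsDomain B] (p : Ideal A) [p.IsPrime]
    [IsLocalization.AtPrime L p] (hL : HenselianLocalRing L) (q₁ q₂ : Ideal B)
    [q₁.IsPrime] [q₂.IsPrime] (h₁ : q₁.comap (algebraMap A B) = p)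
    (h₂ : q₂.comap (algebraMap A B) = p) : q₁ = q₂ := by
  let T := Algebra.algebraMapSubmonoid B p.primeCompl
  let Q := Localization T
  have hdisj : ∀ q : Ideal B, q.comap (algebraMap A B) = p → Disjoint (T : Set B) (q : Set B) := by
    intro q hq
    rw [Set.disjoint_left]
    rintro _ ⟨s, hs, rfl⟩ hm
    apply hs
    rw [← hq]
    exact hm
  have h0 : (0 : B) ∉ T := fun h => Set.disjoint_left.1 (hdisj q₁ h₁) h q₁.zero_mem
  have : IsDomain Q := IsLocalization.isDomain_localization (le_nonZeroDivisors_of_noZeroDivisors h0)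
  let _ : Algebra L Q := localizationAlgebra p.primeCompl B
  have hint : Algebra.IsIntegral L Q := ⟨isIntegral_localization (M := p.primeCompl) (S := B)⟩
  have hcomp : (algebraMap L Q).comp (algebraMap A L) =
      (algebraMap B Q).comp (algebraMap A B) := by
    rw [localizationAlgebraMap_def (M := p.primeCompl) (S := B)]
    exact IsLocalization.map_comp _
  have key : ∀ q : Ideal B, q.IsPrime → q.comap (algebraMap A B) = p →
      (q.map (algebraMap B Q)).IsMaximal ∧ (q.map (algebraMap B Q)).comap (algebraMap B Q) = q := by
    intro q hq hqp
    have e : (q.map (algebraMap B Q)).comap (algebraMap B Q) = q :=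
      IsLocalization.under_map_of_isPrime_disjoint T Q hq (hdisj q hqp)
    have hp := IsLocalization.isPrime_of_isPrime_disjoint T Q q hq (hdisj q hqp)
    refine ⟨?_, e⟩
    apply Ideal.isMaximal_of_isIntegral_of_isMaximal_comap (R := L)
    have : (q.map (algebraMap B Q)).comap (algebraMap L Q) = IsLocalRing.maximalIdeal L := by
      rw [← IsLocalization.map_under p.primeCompl L ((q.map (algebraMap B Q)).comap _),
        ← IsLocalization.map_under p.primeCompl L (IsLocalRing.maximalIdeal L)]
      congr 1
      simp only [Ideal.under]
      rw [Ideal.comap_comap, hcomp, ← Ideal.comap_comap, e, hqp]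
      exact (IsLocalization.AtPrime.comap_maximalIdeal L p).symm
    rw [this]
    infer_instance
  obtain ⟨m₁, e₁⟩ := key q₁ ‹_› h₁
  obtain ⟨m₂, e₂⟩ := key q₂ ‹_› h₂
  rw [← e₁, ← e₂, isLocalRing_of_integral_domain (A := L) (q₁.map (algebraMap B Q))
    (q₂.map (algebraMap B Q))]

/-- Primes over a prime with henselian local ring are unique when the target is irreducible. -/
lemma primes_eq {A B L : Type*} [CommRing A] [CommRing B] [CommRing L] [Algebra A B] [Algebra A L]
    [Algebra.IsIntegral A B] (hB : (nilradical B).IsPrime) (p : Ideal A) [p.IsPrime]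
    [IsLocalization.AtPrime L p] (hL : HenselianLocalRing L) (q₁ q₂ : Ideal B)
    [q₁.IsPrime] [q₂.IsPrime] (h₁ : q₁.comap (algebraMap A B) = p)
    (h₂ : q₂.comap (algebraMap A B) = p) : q₁ = q₂ := by
  have : Algebra.IsIntegral A (B ⧸ nilradical B) := Algebra.IsIntegral.trans B
  let π := Ideal.Quotient.mk (nilradical B)
  have hsurj : Function.Surjective π := Ideal.Quotient.mk_surjective
  have key : ∀ q : Ideal B, q.IsPrime → (q.map π).IsPrime ∧ (q.map π).comap π = q := by
    intro q hq
    have hle : RingHom.ker π ≤ q := by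
      rw [Ideal.mk_ker]; exact nilradical_le_prime q
    refine ⟨Ideal.map_isPrime_of_surjective hsurj hle, ?_⟩
    rw [Ideal.comap_map_of_surjective' _ hsurj, sup_eq_left.2 hle]
  obtain ⟨i₁, e₁⟩ := key q₁ ‹_›
  obtain ⟨i₂, e₂⟩ := key q₂ ‹_›
  have hc : algebraMap A (B ⧸ nilradical B) = π.comp (algebraMap A B) := rfl
  rw [← e₁, ← e₂]
  congr 1
  refine primes_eq_domain (A := A) p hL _ _ ?_ ?_
  · rw [hc, ← Ideal.comap_comap, e₁, h₁]
  · rw [hc, ← Ideal.comap_comap, e₂, h₂]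
end Core

/-- an integral morphism `f : X ⟶ S` with `X` irreducible and `S` locally
henselian has closed image and is a homeomorphism onto its image, i.e. the underlying
continuous map is a closed embedding. -/
theorem integralHom_isClosedEmbedding {X S : Scheme.{u}} (f : X ⟶ S)
    [IsIntegralHom f] [IrreducibleSpace X] (hS : Scheme.IsLocallyHenselian S) :
    Topology.IsClosedEmbedding f.base := by
  refine Topology.IsClosedEmbedding.of_continuous_injective_isClosedMap f.continuous ?_
    f.isClosedMap
  intro x y hxy
  change f x = f y at hxy
  obtain ⟨U, hU, hxU, -⟩ := exists_isAffineOpen_mem_and_subset (X := S) (x := f x) (U := ⊤) trivial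
  have hV : IsAffineOpen (f ⁻¹ᵁ U) := hU.preimage f
  have hx : x ∈ f ⁻¹ᵁ U := hxU
  have hy : y ∈ f ⁻¹ᵁ U := by change f y ∈ U; rw [← hxy]; exact hxU
  have e1 := IsAffineOpen.comap_primeIdealOf_appLE U hU _ hV le_rfl hx
  have e2 := IsAffineOpen.comap_primeIdealOf_appLE U hU _ hV le_rfl hy
  have e3 : hU.primeIdealOf ⟨f y, hy⟩ = hU.primeIdealOf ⟨f x, hx⟩ := by
    congr 1; exact Subtype.ext hxy.symm
  rw [e3] at e2
  have hirr : IrreducibleSpace (f ⁻¹ᵁ U) :=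
    Subtype.irreducibleSpace (s := ((f ⁻¹ᵁ U : X.Opens) : Set X))
      ⟨⟨x, hx⟩, (PreirreducibleSpace.isPreirreducible_univ (X := X)).open_subset
        (f ⁻¹ᵁ U).2 (Set.subset_univ _)⟩
  have hirr2 : IrreducibleSpace (PrimeSpectrum Γ(X, f ⁻¹ᵁ U)) :=
    (Scheme.homeoOfIso hV.isoSpec).surjective.irreducibleSpace
      (Scheme.homeoOfIso hV.isoSpec).continuous
  have hnil := PrimeSpectrum.irreducibleSpace_iff_isPrime_nilradical.1 hirr2
  have hint : (f.appLE U (f ⁻¹ᵁ U) le_rfl).hom.IsIntegral := by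
    rw [Scheme.Hom.appLE_eq_app]
    exact f.isIntegral_app U hU
  let _ : Algebra Γ(S, U) Γ(X, f ⁻¹ᵁ U) := (f.appLE U (f ⁻¹ᵁ U) le_rfl).hom.toAlgebra
  have : Algebra.IsIntegral Γ(S, U) Γ(X, f ⁻¹ᵁ U) := ⟨hint⟩
  let _ : Algebra Γ(S, U) (S.presheaf.stalk (f x)) :=
    TopCat.Presheaf.algebra_section_stalk S.presheaf (⟨f x, hx⟩ : U)
  have : IsLocalization.AtPrime (S.presheaf.stalk (f x)) (hU.primeIdealOf ⟨f x, hx⟩).asIdeal :=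
    hU.isLocalization_stalk ⟨f x, hx⟩
  have h := primes_eq (L := S.presheaf.stalk (f x)) hnil (hU.primeIdealOf ⟨f x, hx⟩).asIdeal
    (hS (f x)) (hV.primeIdealOf ⟨x, hx⟩).asIdeal (hV.primeIdealOf ⟨y, hy⟩).asIdeal
    (congrArg PrimeSpectrum.asIdeal e1) (congrArg PrimeSpectrum.asIdeal e2)
  have h' : hV.primeIdealOf ⟨x, hx⟩ = hV.primeIdealOf ⟨y, hy⟩ := PrimeSpectrum.ext h
  have hx' := hV.fromSpec_primeIdealOf ⟨x, hx⟩
  rw [h', hV.fromSpec_primeIdealOf ⟨y, hy⟩] at hx'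
  exact hx'.symm
end

section
/- Let R be a henselian local ring with maximal ideal m and let A be a commutative R-algebra that is integral over R. If the prime spectrum of A is preconnected, then the prime spectrum of A/mA (the quotient of A by the ideal generated by the image of m) is preconnected. -/
universe u v

open Polynomial in
/-- Points of étale algebras over henselian local rings lift. -/
lemma aux_lift_point {R : Type u} {R' : Type v} [CommRing R] [HenselianLocalRing R]
    [CommRing R'] [Algebra R R'] [Algebra.Etale R R']
    (ψ : R' →ₐ[R] IsLocalRing.ResidueField R) :
    ∃ φ : R' →ₐ[R] R, (Algebra.ofId R (IsLocalRing.ResidueField R)).comp φ = ψ := by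
  let Q := RingHom.ker ψ.toRingHom
  have hQ : Q.IsPrime := RingHom.ker_isPrime _
  obtain ⟨s, hs, hst⟩ := Algebra.IsEtaleAt.exists_isStandardEtale (R := R) Q
  obtain ⟨P⟩ := hst.nonempty_standardEtalePresentation
  have hu : IsUnit (ψ s) := IsUnit.mk0 _ hs
  let ψ' : Localization.Away s →ₐ[R] IsLocalRing.ResidueField R :=
    IsLocalization.liftAlgHom (M := Submonoid.powers s) (f := ψ) (by
      rintro ⟨_, n, rfl⟩
      simpa using hu.pow n)
  have hpsi : ∀ x : R', ψ' (algebraMap R' _ x) = ψ x := by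
    intro x
    simp [ψ']
  have hm := P.hasMap.map ψ'
  obtain ⟨a₀, ha₀⟩ := IsLocalRing.residue_surjective (ψ' P.x)
  have hev : ∀ q : R[X], ∀ b : R, IsLocalRing.residue R b = ψ' P.x →
      IsLocalRing.residue R (q.eval b) = aeval (ψ' P.x) q := by
    intro q b hb
    rw [← hb, ← IsLocalRing.ResidueField.algebraMap_eq, aeval_algebraMap_apply]
    simp
  have hunit : ∀ q : R[X], ∀ b : R, IsLocalRing.residue R b = ψ' P.x →
      IsUnit (aeval (ψ' P.x) q) → IsUnit (q.eval b) := by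
    intro q b hb h
    rw [← hev q b hb] at h
    exact (isUnit_map_iff (IsLocalRing.residue R) _).mp h
  obtain ⟨a, ha, haa⟩ := HenselianLocalRing.is_henselian P.f P.monic_f a₀
    (by rw [← IsLocalRing.residue_eq_zero_iff, hev _ _ ha₀]; exact hm.1)
    (hunit _ _ ha₀ hm.isUnit_derivative_f)
  have hra : IsLocalRing.residue R a = ψ' P.x := by
    rw [← ha₀, ← sub_eq_zero, ← map_sub, IsLocalRing.residue_eq_zero_iff]
    exact haa
  have hmap : P.HasMap a := ⟨by simpa using ha, by simpa using hunit _ _ hra hm.2⟩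
  let φ : Localization.Away s →ₐ[R] R := (P.lift a hmap).comp P.equivRing.toAlgHom
  have hφ : (Algebra.ofId R (IsLocalRing.ResidueField R)).comp φ = ψ' := by
    apply P.hom_ext
    simp only [AlgHom.comp_apply, φ]
    simpa [Algebra.ofId_apply] using hra
  refine ⟨φ.comp (IsScalarTower.toAlgHom R R' _), ?_⟩
  rw [← AlgHom.comp_assoc, hφ]
  ext x
  simp [hpsi]

open Polynomial in
/-- Coprime factorizations lift over henselian local rings. -/
lemma aux_lift_factor {R : Type u} [CommRing R] [HenselianLocalRing R]
    (p : R[X]) (hp : p.Monic) (f g : (IsLocalRing.ResidueField R)[X]) (hf : f.Monic) (hg : g.Monic)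
    (H : p.map (IsLocalRing.residue R) = f * g) (Hc : IsCoprime f g) :
    ∃ F G : R[X], p = F * G ∧ IsCoprime F G ∧
      F.map (IsLocalRing.residue R) = f ∧ G.map (IsLocalRing.residue R) = g := by
  have hn : p.natDegree = f.natDegree + g.natDegree := by
    rw [← hf.natDegree_mul hg, ← H, hp.natDegree_map]
  let p' : MonicDegreeEq R p.natDegree := .mk p hp rfl
  let E := UniversalCoprimeFactorizationRing.homEquiv (IsLocalRing.ResidueField R)
    f.natDegree g.natDegree hn p'
  let E' := UniversalCoprimeFactorizationRing.homEquiv R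
    f.natDegree g.natDegree hn p'
  let q : { q : MonicDegreeEq (IsLocalRing.ResidueField R) f.natDegree ×
      MonicDegreeEq (IsLocalRing.ResidueField R) g.natDegree //
      q.1.1 * q.2.1 = p'.1.map (algebraMap R _) ∧ IsCoprime q.1.1 q.2.1 } :=
    ⟨(.mk f hf rfl, .mk g hg rfl), H.symm, Hc⟩
  obtain ⟨φ, hφ⟩ := aux_lift_point (E.symm q)
  have h1 := UniversalCoprimeFactorizationRing.homEquiv_comp_fst _ f.natDegree g.natDegree hn p' φ
    (Algebra.ofId R (IsLocalRing.ResidueField R))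
  have h2 := UniversalCoprimeFactorizationRing.homEquiv_comp_snd _ f.natDegree g.natDegree hn p' φ
    (Algebra.ofId R (IsLocalRing.ResidueField R))
  rw [hφ] at h1 h2
  have h3 : E (E.symm q) = q := E.apply_symm_apply q
  refine ⟨(E' φ).1.1.1, (E' φ).1.2.1, ?_, (E' φ).2.2, ?_, ?_⟩
  · have := (E' φ).2.1
    simpa [p'] using this.symm
  · have := h1.symm.trans (congrArg (fun z => z.1.1) h3)
    exact congrArg Subtype.val this
  · have := h2.symm.trans (congrArg (fun z => z.1.2) h3)
    exact congrArg Subtype.val this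

open Polynomial in
/-- Idempotents lift along `A → A/mA`. -/
lemma aux_lift_idem (R : Type u) (A : Type v) [CommRing R] [HenselianLocalRing R]
    [CommRing A] [Algebra R A] [Algebra.IsIntegral R A]
    (e : A ⧸ (IsLocalRing.maximalIdeal R).map (algebraMap R A)) (he : IsIdempotentElem e) :
    ∃ e₀ : A, IsIdempotentElem e₀ ∧ Ideal.Quotient.mk _ e₀ = e := by
  obtain ⟨a, rfl⟩ := Ideal.Quotient.mk_surjective e
  set I := (IsLocalRing.maximalIdeal R).map (algebraMap R A) with hI
  set e := Ideal.Quotient.mk I a with hea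
  obtain ⟨f₀, hf₀, hf₀a⟩ := Algebra.IsIntegral.isIntegral (R := R) a
  let p : R[X] := X * ((X - 1) * f₀)
  have hp : p.Monic := monic_X.mul ((monic_X_sub_C 1).mul hf₀)
  have hpa : aeval a p = 0 := by
    have : aeval a f₀ = 0 := hf₀a
    simp [p, this]
  let ρ := IsLocalRing.residue R
  have hp0 : p.map ρ ≠ 0 := (hp.map ρ).ne_zero
  obtain ⟨g, hg, hgn⟩ := exists_eq_pow_rootMultiplicity_mul_and_not_dvd (p.map ρ) hp0 0
  set j := (p.map ρ).rootMultiplicity 0 with hj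
  have hj0 : j ≠ 0 := by
    have : 0 < j := (rootMultiplicity_pos hp0).2 (by simp [p, IsRoot])
    exact this.ne'
  rw [C_0, sub_zero] at hg hgn
  have hgm : g.Monic := (monic_X_pow j).of_mul_monic_left (hg ▸ hp.map ρ)
  have hc : IsCoprime (X ^ j) g :=
    IsCoprime.pow_left ((irreducible_X.coprime_iff_not_dvd).2 hgn)
  have hdvd : (X - 1 : (IsLocalRing.ResidueField R)[X]) ∣ g := by
    have h1 : (X - 1 : (IsLocalRing.ResidueField R)[X]) ∣ X ^ j * g := by
      rw [← hg]
      exact ⟨X * f₀.map ρ, by simp [p]; ring⟩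
    refine IsCoprime.dvd_of_dvd_mul_left (IsCoprime.pow_right ?_) h1
    exact ⟨-1, 1, by ring⟩
  obtain ⟨F, G, hFG, ⟨u, v, huv⟩, hF, hG⟩ := aux_lift_factor p hp _ g (monic_X_pow j) hgm hg hc
  let κ : IsLocalRing.ResidueField R →+* A ⧸ I :=
    Ideal.quotientMap I (algebraMap R A) Ideal.le_comap_map
  have hκ : ∀ q : R[X], Ideal.Quotient.mk I (aeval a q) = eval₂ κ e (q.map ρ) := by
    intro q
    rw [eval₂_map, aeval_def, hom_eval₂]
    rfl
  have hk : ∀ n : ℕ, n ≠ 0 → e ^ n = e := fun n hn => he.pow_eq hn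
  have hF' : Ideal.Quotient.mk I (aeval a F) = e := by
    rw [hκ, hF, eval₂_pow, eval₂_X, hk j hj0]
  have hGz : e * Ideal.Quotient.mk I (aeval a G) = 0 := by
    obtain ⟨w, hw⟩ := hdvd
    rw [hκ, hG, hw, eval₂_mul, eval₂_sub, eval₂_X, eval₂_one, ← mul_assoc, mul_sub, he.eq]
    simp
  have huv' : aeval a u * aeval a F + aeval a v * aeval a G = 1 := by
    simpa using congrArg (aeval a) huv
  have hFG' : aeval a F * aeval a G = 0 := by
    rw [← map_mul, ← hFG, hpa]
  refine ⟨aeval a u * aeval a F, ?_, ?_⟩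
  · unfold IsIdempotentElem
    linear_combination (aeval a u * aeval a F) * huv' - aeval a u * aeval a v * hFG'
  · have h := congrArg (Ideal.Quotient.mk I) huv'
    simp only [map_add, map_mul, map_one, hF'] at h ⊢
    have he' : e * e = e := he
    linear_combination e * h - Ideal.Quotient.mk I (aeval a u) * he' -
      Ideal.Quotient.mk I (aeval a v) * hGz

/-- if `R` is a henselian local ring with maximal ideal `m` and `A` is a
commutative `R`-algebra which is integral over `R`, then preconnectedness of `Spec A`
implies preconnectedness of `Spec (A ⧸ mA)`. -/
theorem preconnected_spec_quotient_of_henselian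
    (R : Type u) (A : Type v) [CommRing R] [HenselianLocalRing R]
    [CommRing A] [Algebra R A] [Algebra.IsIntegral R A]
    (h : PreconnectedSpace (PrimeSpectrum A)) :
    PreconnectedSpace
      (PrimeSpectrum (A ⧸ (IsLocalRing.maximalIdeal R).map (algebraMap R A))) := by
  rw [preconnectedSpace_iff_clopen] at h ⊢
  intro s hs
  obtain ⟨e, he, rfl⟩ := PrimeSpectrum.isClopen_iff.mp hs
  obtain ⟨e₀, he₀, rfl⟩ := aux_lift_idem R A e he
  let π := Ideal.Quotient.mk ((IsLocalRing.maximalIdeal R).map (algebraMap R A))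
  have hpre : (PrimeSpectrum.basicOpen (π e₀) : Set (PrimeSpectrum
      (A ⧸ (IsLocalRing.maximalIdeal R).map (algebraMap R A)))) =
      PrimeSpectrum.comap π ⁻¹' (PrimeSpectrum.basicOpen e₀ : Set (PrimeSpectrum A)) := rfl
  erw [hpre]
  rcases h _ (PrimeSpectrum.isClopen_iff.mpr ⟨e₀, he₀, rfl⟩) with h | h
  · left; rw [h]; rfl
  · right; rw [h]; rfl
end

section
/- Let S be a scheme, let X be a scheme fet over S with set-theoretic image U in S, and let {f_i : X_i → X} be a family of S-morphisms with each X_i fet over S whose images jointly cover X. Then there exist an open covering U = ⋃_j U_j and, for each index j, a finite family of S-morphisms {g_{j,k} : X_{j,k} → X_{U_j}} to the preimage X_{U_j} of U_j in X, such that: each X_{j,k} is an open subscheme of some X_i and the composite X_{j,k} → X_{U_j} → X agrees with the restriction of the corresponding f_i; each X_{j,k} is finite étale over U_j; and for each j the morphisms g_{j,k} are jointly surjective onto X_{U_j}. -/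
open AlgebraicGeometry CategoryTheory

universe u

lemma IsFet.isEtale {X Y : Scheme.{u}} {f : X ⟶ Y} (h : IsFet f) : Etale f := by
  obtain ⟨Z, g, h, hg, hg', hh, rfl⟩ := h
  have : Etale g := hg'
  infer_instance

lemma restrict_finite_etale {X Z S : Scheme.{u}} (g : X ⟶ Z) (h : Z ⟶ S) [IsFinite g] [Etale g]
    [IsOpenImmersion h] (V : S.Opens) (hV : V ≤ h.opensRange) :
    IsFinite ((g ≫ h) ∣_ V) ∧ Etale ((g ≫ h) ∣_ V) := by
  have hI : IsIso (h ∣_ V) := by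
    have : Surjective (h ∣_ V) := by
      constructor
      rintro ⟨v, hv⟩
      obtain ⟨z, rfl⟩ := hV hv
      refine ⟨⟨z, hv⟩, ?_⟩
      apply Subtype.ext
      exact morphismRestrict_base_coe h V ⟨z, hv⟩
    exact (isIso_iff_isOpenImmersion_and_surjective _).2 ⟨inferInstance, this⟩
  rw [morphismRestrict_comp]
  have h1 : IsFinite (g ∣_ h ⁻¹ᵁ V) := inferInstance
  have h2 : Etale (g ∣_ h ⁻¹ᵁ V) := inferInstance
  have h3 : IsFinite (h ∣_ V) := inferInstance
  have h4 : Etale (h ∣_ V) := inferInstance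
  exact ⟨MorphismProperty.comp_mem @IsFinite _ _ h1 h3, @Etale.etale_comp _ _ _ _ _ h2 h4⟩

theorem fet_cover_refinement {S X : Scheme.{u}} (p : X ⟶ S) (hp : IsFet p)
    {ι : Type u} (Xf : ι → Scheme.{u}) (q : ∀ i, Xf i ⟶ S) (hq : ∀ i, IsFet (q i))
    (f : ∀ i, Xf i ⟶ X) (hcomm : ∀ i, f i ≫ p = q i)
    (hcover : (⋃ i, Set.range (f i).base) = Set.univ) :
    ∃ (J : Type u) (V : J → S.Opens),
      (⋃ j, (V j : Set S)) = Set.range p.base ∧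
      ∀ j, ∃ (K : Type u) (_ : Finite K) (idx : K → ι)
        (W : ∀ k, (Xf (idx k)).Opens)
        (g : ∀ k, (W k).toScheme ⟶ (p ⁻¹ᵁ V j).toScheme),
        (∀ k, g k ≫ (p ⁻¹ᵁ V j).ι = (W k).ι ≫ f (idx k)) ∧
        (∀ k, IsFinite (g k ≫ (p ∣_ V j)) ∧ IsEtale (g k ≫ (p ∣_ V j))) ∧
        (⋃ k, Set.range (g k).base) = Set.univ := by
  have hpe : Etale p := hp.isEtale
  have hfe : ∀ i, Etale (f i) := fun i ↦ by
    have : Etale (f i ≫ p) := by rw [hcomm]; exact (hq i).isEtale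
    exact MorphismProperty.of_postcomp @Etale (W' := @Etale) (f i) p hpe this
  have hqV : ∀ i, ∃ R : S.Opens, (∀ y, q i y ∈ R) ∧ ∀ V ≤ R,
      IsFinite (q i ∣_ V) ∧ Etale (q i ∣_ V) := by
    intro i
    obtain ⟨Z, g, h, hg, hg', hh, e⟩ := hq i
    have : Etale g := hg'
    rw [← e]
    exact ⟨h.opensRange, fun y ↦ ⟨g y, by simp⟩, fun V hV ↦ restrict_finite_etale g h V hV⟩
  choose R hR hRV using hqV
  have hx : ∀ x : X, ∃ i, ∃ y, f i y = x := fun x ↦ by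
    have := hcover.ge (Set.mem_univ x)
    simpa using this
  choose idx y hy using hx
  have key : ∀ s ∈ Set.range p, ∃ V : S.Opens, s ∈ V ∧ (V : Set S) ⊆ Set.range p ∧
      (∀ x, p x = s → V ≤ R (idx x)) ∧
      (∀ x, p x ∈ V → ∃ x', p x' = s ∧ x ∈ Set.range (f (idx x'))) ∧
      (p ⁻¹' {s}).Finite := by
    obtain ⟨Z, g, h, hg, hg', hh, rfl⟩ := hp
    rintro s ⟨x₀, rfl⟩
    have hinj : Function.Injective h := h.isOpenEmbedding.injective
    set F : Set X := (g ≫ h) ⁻¹' {(g ≫ h) x₀} with hF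
    have hfin : F.Finite := by
      have : F = g ⁻¹' {g x₀} := by
        ext x
        simp [hF, hinj.eq_iff]
      rw [this]
      exact g.finite_preimage_singleton _
    let O : Set X := ⋃ x ∈ F, Set.range (f (idx x))
    have hO : IsOpen O := isOpen_biUnion fun x _ ↦ (f (idx x)).isOpenMap.isOpen_range
    have hT : IsClosed (g '' Oᶜ) := g.isClosedMap _ hO.isClosed_compl
    have h1 : IsOpen (h '' (g '' Oᶜ)ᶜ) := h.isOpenEmbedding.isOpenMap _ hT.isOpen_compl
    have h2 : IsOpen (⋂ x ∈ F, (R (idx x) : Set S)) :=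
      hfin.isOpen_biInter fun x _ ↦ (R (idx x)).2
    have h3 : IsOpen (Set.range (g ≫ h)) := (g ≫ h).isOpenMap.isOpen_range
    refine ⟨⟨_, (h1.inter h2).inter h3⟩, ⟨⟨⟨g x₀, ?_, by simp⟩, ?_⟩, ⟨x₀, rfl⟩⟩,
      Set.inter_subset_right, ?_, ?_, hfin⟩
    · rintro ⟨x, hxO, hx⟩
      apply hxO
      refine Set.mem_biUnion (x := x) ?_ ⟨y x, hy x⟩
      simp [hF, hx]
    · simp only [Set.mem_iInter]
      intro x hx
      have := hR (idx x) (y x)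
      rw [← hcomm, Scheme.Hom.comp_apply, hy] at this
      rw [← show (g ≫ h) x = (g ≫ h) x₀ from hx]
      exact this
    · intro x hx v hv
      have := hv.1.2
      simp only [Set.mem_iInter] at this
      exact this x hx
    · rintro x ⟨⟨⟨z, hz, hzx⟩, -⟩, -⟩
      have : z = g x := hinj (by simpa using hzx)
      subst this
      have hxO : x ∈ O := by
        by_contra hc
        exact hz ⟨x, hc, rfl⟩
      simpa [O, hF] using hxO
  choose! V hV1 hV2 hV3 hV4 hV5 using key
  refine ⟨Set.range p, fun j ↦ V j, ?_, ?_⟩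
  · apply subset_antisymm
    · exact Set.iUnion_subset fun j ↦ hV2 j.1 j.2
    · intro s hs
      exact Set.mem_iUnion.2 ⟨⟨s, hs⟩, hV1 s hs⟩
  · rintro ⟨s, hs⟩
    have e : ∀ i, q i ⁻¹ᵁ V s ≤ f i ⁻¹ᵁ (p ⁻¹ᵁ V s) := fun i ↦ by
      rw [← hcomm]; exact le_rfl
    refine ⟨p ⁻¹' {s}, hV5 s hs, fun x ↦ idx x, fun x ↦ q (idx x) ⁻¹ᵁ V s,
      fun x ↦ (f (idx x)).resLE _ _ (e _), fun x ↦ by simp, fun x ↦ ?_, ?_⟩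
    · have : (f (idx x)).resLE _ _ (e _) ≫ (p ∣_ V s) = q (idx x) ∣_ V s := by
        rw [← cancel_mono (V s).ι]
        simp [hcomm]
      rw [this]
      exact hRV _ _ (hV3 s hs x x.2)
    · rw [Set.eq_univ_iff_forall]
      rintro ⟨x, hx⟩
      obtain ⟨x', hx', w, hw⟩ := hV4 s hs x hx
      refine Set.mem_iUnion.2 ⟨⟨x', hx'⟩, ⟨w, ?_⟩, ?_⟩
      · change q _ w ∈ V s
        rw [← hcomm, Scheme.Hom.comp_apply, hw]
        exact hx
      · apply Subtype.ext
        exact (Scheme.Hom.coe_resLE_apply (f (idx x')) (e (idx x')) _).trans hw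
end
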